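/- 80/(3π) = ∑_{n=0}^∞ (1/16^n) · [(1/2)_n (1/4)_n (3/4)_n (3/8)_n (7/8)_n / ((1)_n³ (9/8)_n (13/8)_n)] · (640n³ + 560n² + 112n + 7). -/

import Mathlib

open Real

/-- Pochhammer symbol (x)_n = x (x+1) ⋯ (x+n-1). -/
noncomputable def poch (x : ℝ) (n : ℕ) : ℝ :=
  ∏ k ∈ Finset.range n, (x + k)

lemma poch_succ (x : ℝ) (n : ℕ) : poch x (n+1) = poch x n * (x + n) := by
  unfold poch; rw [Finset.prod_range_succ]

lemma poch_zero (x : ℝ) : poch x 0 = 1 := by simp [poch]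

lemma poch_pos {x : ℝ} (hx : 0 < x) (n : ℕ) : 0 < poch x n := by
  unfold poch; exact Finset.prod_pos fun i _ => by positivity

lemma poch_shift {x : ℝ} (hx : 0 < x) (n : ℕ) : poch (x+1) n = poch x n * (x + n) / x := by
  induction n with
  | zero => simp [poch_zero]; field_simp
  | succ k ih => rw [poch_succ, ih, poch_succ]; push_cast; field_simp; ring

/-- the comparison sequence -/
noncomputable def xx (k : ℕ) : ℝ := poch (1/4) k / poch 1 k

lemma xx_pos (k : ℕ) : 0 < xx k := div_pos (poch_pos (by norm_num) k) (poch_pos (by norm_num) k)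

lemma xx_succ (k : ℕ) : xx (k+1) = xx k * ((1/4 + k) / (1 + k)) := by
  have := poch_pos (x := 1) (by norm_num) k
  unfold xx; rw [poch_succ, poch_succ]; field_simp

lemma xx_bound (k : ℕ) : xx k ^ 4 * ((k:ℝ)+1)^3 ≤ 1 := by
  induction k with
  | zero => simp [xx, poch_zero]
  | succ k ih =>
    refine le_trans ?_ ih
    rw [xx_succ, mul_pow, mul_assoc]
    apply mul_le_mul_of_nonneg_left _ (by have := xx_pos k; positivity)
    have hk : (0:ℝ) ≤ k := by positivity
    rw [div_pow, div_mul_eq_mul_div, div_le_iff₀ (by positivity)]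
    push_cast
    ring_nf
    nlinarith [pow_nonneg hk 2, pow_nonneg hk 3, pow_nonneg hk 4, pow_nonneg hk 5]

lemma xx_le (k : ℕ) : xx k ^ 3 ≤ ((k:ℝ)+1)^(-(9/4) : ℝ) := by
  have hx := xx_pos k
  have hk : (0:ℝ) < (k:ℝ)+1 := by positivity
  have h : xx k ≤ ((k:ℝ)+1)^(-(3/4) : ℝ) := by
    rw [← pow_le_pow_iff_left₀ hx.le (by positivity) (n := 4) (by norm_num)]
    rw [← Real.rpow_natCast (_ ^ _), ← Real.rpow_mul hk.le]
    norm_num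
    rw [← one_div, le_div_iff₀ (by positivity)]
    exact xx_bound k
  calc xx k ^ 3 ≤ (((k:ℝ)+1)^(-(3/4) : ℝ))^3 := by gcongr
    _ = _ := by rw [← Real.rpow_natCast (_ ^ _), ← Real.rpow_mul hk.le]; norm_num

lemma summ_dom : Summable (fun k : ℕ => ((k:ℝ)+1) * xx k ^ 3) := by
  have h : Summable (fun k : ℕ => ((k:ℝ)+1)^(-(5/4) : ℝ)) := by
    have := (summable_nat_add_iff 1).2 (Real.summable_nat_rpow (p := -(5/4)).2 (by norm_num))
    simpa using this
  refine Summable.of_nonneg_of_le (fun k => by have := xx_pos k; positivity) (fun k => ?_) h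
  have hk : (0:ℝ) < (k:ℝ)+1 := by positivity
  calc ((k:ℝ)+1) * xx k ^ 3 ≤ ((k:ℝ)+1)^(1:ℝ) * ((k:ℝ)+1)^(-(9/4) : ℝ) := by
        rw [Real.rpow_one]; exact mul_le_mul_of_nonneg_left (xx_le k) hk.le
    _ = _ := by rw [← Real.rpow_add hk]; norm_num

lemma lim_dom : Filter.Tendsto (fun k : ℕ => ((k:ℝ)+1)^2 * xx k ^ 3) Filter.atTop (nhds 0) := by
  have h : Filter.Tendsto (fun k : ℕ => ((k:ℝ)+1)^(-(1/4) : ℝ)) Filter.atTop (nhds 0) := by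
    have h1 := (tendsto_rpow_neg_atTop (y := 1/4) (by norm_num)).comp
      (Filter.tendsto_atTop_add_const_right Filter.atTop (1:ℝ) (tendsto_natCast_atTop_atTop (R := ℝ)))
    exact h1
  refine squeeze_zero (fun k => by have := xx_pos k; positivity) (fun k => ?_) h
  have hk : (0:ℝ) < (k:ℝ)+1 := by positivity
  calc ((k:ℝ)+1)^2 * xx k ^ 3 ≤ ((k:ℝ)+1)^(2:ℝ) * ((k:ℝ)+1)^(-(9/4) : ℝ) := by
        rw [Real.rpow_two]; exact mul_le_mul_of_nonneg_left (xx_le k) (by positivity)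
    _ = _ := by rw [← Real.rpow_add hk]; norm_num

/-! First family -/

noncomputable def v1 (n k : ℕ) : ℝ :=
  poch (n + 1/2) k * poch (n + 1/4) k * poch (1/4) k ^ 2 /
    (poch (n + 3/4) k * poch (n + 1) k * poch (2 * n + 1) k ^ 2)

noncomputable def w1 (n k : ℕ) : ℝ := (1/4 + 2 * n + 2 * k) * v1 n k

noncomputable def P1 (n k : ℝ) : ℝ :=
  (21/16 + 105/4*n + 777/4*n^2 + 624*n^3 + 900*n^4 + 480*n^5)
  + (16 + 208*n + 912*n^2 + 1632*n^3 + 1024*n^4) * k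
  + (43 + 374*n + 968*n^2 + 768*n^3) * k^2
  + (50 + 240*n + 256*n^2) * k^3 + (20 + 32*n) * k^4

noncomputable def h1 (n k : ℕ) : ℝ := v1 n k * P1 n k / (2 * n + 1 + k)^2

noncomputable def AA (n : ℕ) : ℝ := (1 / 16 ^ n) *
      (poch (1/2) n * poch (1/4) n * poch (3/4) n * poch (3/8) n * poch (7/8) n /
        (poch 1 n ^ 3 * poch (9/8) n * poch (13/8) n))

lemma v1_pos (n k : ℕ) : 0 < v1 n k := by
  have h1 := poch_pos (x := (n:ℝ) + 1/2) (by positivity) k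
  have h2 := poch_pos (x := (n:ℝ) + 1/4) (by positivity) k
  have h3 := poch_pos (x := (1/4 : ℝ)) (by positivity) k
  have h4 := poch_pos (x := (n:ℝ) + 3/4) (by positivity) k
  have h5 := poch_pos (x := (n:ℝ) + 1) (by positivity) k
  have h6 := poch_pos (x := 2 * (n:ℝ) + 1) (by positivity) k
  unfold v1; positivity

lemma v1_succ_k (n k : ℕ) : v1 n (k+1) = v1 n k *
    ((n + 1/2 + k) * (n + 1/4 + k) * (1/4 + k)^2 /
      ((n + 3/4 + k) * (n + 1 + k) * (2 * n + 1 + k)^2)) := by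
  have h4 := poch_pos (x := (n:ℝ) + 3/4) (by positivity) k
  have h5 := poch_pos (x := (n:ℝ) + 1) (by positivity) k
  have h6 := poch_pos (x := 2 * (n:ℝ) + 1) (by positivity) k
  have e4 : (n:ℝ) + 3/4 + k ≠ 0 := by positivity
  unfold v1; simp only [poch_succ]
  rw [div_mul_div_comm]; congr 1 <;> ring

lemma v1_succ_n (n k : ℕ) : v1 (n+1) k = v1 n k *
    (((n + 1/2 + k) / (n + 1/2)) * ((n + 1/4 + k) / (n + 1/4)) *
      ((n + 3/4) / (n + 3/4 + k)) * ((n + 1) / (n + 1 + k)) *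
      (((2 * n + 1) * (2 * n + 2)) / ((2 * n + 1 + k) * (2 * n + 2 + k)))^2) := by
  have h4 := poch_pos (x := (n:ℝ) + 3/4) (by positivity) k
  have h5 := poch_pos (x := (n:ℝ) + 1) (by positivity) k
  have h6 := poch_pos (x := 2 * (n:ℝ) + 1) (by positivity) k
  unfold v1
  push_cast
  rw [show (n:ℝ) + 1 + 1/2 = (n + 1/2) + 1 by ring, show (n:ℝ) + 1 + 1/4 = (n + 1/4) + 1 by ring,
    show (n:ℝ) + 1 + 3/4 = (n + 3/4) + 1 by ring, show 2 * ((n:ℝ) + 1) + 1 = (2 * n + 1) + 1 + 1 by ring,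
    poch_shift (by positivity), poch_shift (x := (n:ℝ) + 1/4) (by positivity),
    poch_shift (x := (n:ℝ) + 3/4) (by positivity), poch_shift (x := (n:ℝ) + 1) (by positivity),
    poch_shift (x := 2 * (n:ℝ) + 1 + 1) (by positivity), poch_shift (x := 2 * (n:ℝ) + 1) (by positivity)]
  rw [show 2 * (n:ℝ) + 1 + 1 = 2 * n + 2 by ring]
  generalize poch ((n:ℝ) + 3/4) k = a4 at *
  generalize poch ((n:ℝ) + 1) k = a5 at *
  generalize poch (2 * (n:ℝ) + 1) k = a6 at *
  field_simp

lemma AA_pos (n : ℕ) : 0 < AA n := by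
  have h1 := poch_pos (x := 1/2) (by positivity) n
  have h2 := poch_pos (x := 1/4) (by positivity) n
  have h3 := poch_pos (x := 3/4) (by positivity) n
  have h4 := poch_pos (x := 3/8) (by positivity) n
  have h5 := poch_pos (x := 7/8) (by positivity) n
  have h6 := poch_pos (x := 1) (by positivity) n
  have h7 := poch_pos (x := 9/8) (by positivity) n
  have h8 := poch_pos (x := 13/8) (by positivity) n
  unfold AA; positivity

lemma AA_succ (n : ℕ) : AA (n+1) = AA n * ((1/16) *
    ((1/2 + n) * (1/4 + n) * (3/4 + n) * (3/8 + n) * (7/8 + n)) /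
      ((1 + n)^3 * (9/8 + n) * (13/8 + n))) := by
  have h6 := poch_pos (x := 1) (by positivity) n
  have h7 := poch_pos (x := 9/8) (by positivity) n
  have h8 := poch_pos (x := 13/8) (by positivity) n
  unfold AA; simp only [poch_succ]
  generalize poch 1 n = a1 at *
  generalize poch (9/8) n = a2 at *
  generalize poch (13/8) n = a3 at *
  rw [pow_succ]
  field_simp

lemma v1_le (n k : ℕ) : v1 n k ≤ xx k ^ 3 := by
  induction k with
  | zero => simp [v1, xx, poch_zero]
  | succ k ih =>
    rw [v1_succ_k, xx_succ, mul_pow]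
    apply mul_le_mul ih _ (by positivity) (by have := xx_pos k; positivity)
    have hk : (0:ℝ) ≤ k := by positivity
    have e1 : ((n:ℝ) + 1/2 + k) / (n + 3/4 + k) ≤ 1 := by
      rw [div_le_one (by positivity)]; linarith
    have e2 : ((n:ℝ) + 1/4 + k) * (1/4 + k)^2 / ((n + 1 + k) * (2 * n + 1 + k)^2) ≤ ((1/4 + k)/(1+k))^3 := by
      rw [div_pow, div_le_div_iff₀ (by positivity) (by positivity)]
      rcases Nat.eq_zero_or_pos n with rfl | hn
      · simp; apply le_of_eq; ring
      · obtain ⟨m, rfl⟩ := Nat.exists_eq_add_of_le' hn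
        push_cast
        have hm : (0:ℝ) ≤ m := by positivity
        have a : ((m:ℝ) + 1 + 1/4 + k) * (1+k)^2 ≤ (1/4 + k) * (m + 1 + 1 + k) * (2 * (m + 1) + 1 + k) := by
          have : 0 ≤ (m:ℝ) * k := by positivity
          have : 0 ≤ (m:ℝ) * k^2 := by positivity
          have : 0 ≤ (m:ℝ)^2 * k := by positivity
          nlinarith
        have b : (1 + (k:ℝ)) ≤ (2 * (m + 1) + 1 + k) := by linarith
        calc ((m:ℝ) + 1 + 1/4 + (k:ℝ)) * (1/4 + (k:ℝ))^2 * (1+(k:ℝ))^3 = (1/4 + (k:ℝ))^2 * (((m:ℝ) + 1 + 1/4 + (k:ℝ)) * (1+(k:ℝ))^2) * (1 + (k:ℝ)) := by ring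
          _ ≤ (1/4 + (k:ℝ))^2 * ((1/4 + (k:ℝ)) * (m + 1 + 1 + (k:ℝ)) * (2 * (m + 1) + 1 + (k:ℝ))) * (2 * (m + 1) + 1 + (k:ℝ)) := by gcongr
          _ = _ := by ring
    calc ((n:ℝ) + 1/2 + (k:ℝ)) * (n + 1/4 + (k:ℝ)) * (1/4 + (k:ℝ))^2 /
      ((n + 3/4 + (k:ℝ)) * (n + 1 + (k:ℝ)) * (2 * n + 1 + (k:ℝ))^2) = ((n:ℝ) + 1/2 + (k:ℝ)) / (n + 3/4 + (k:ℝ)) *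
        (((n:ℝ) + 1/4 + (k:ℝ)) * (1/4 + (k:ℝ))^2 / ((n + 1 + (k:ℝ)) * (2 * n + 1 + (k:ℝ))^2)) := by
          rw [div_mul_div_comm]; congr 1 <;> ring
      _ ≤ 1 * ((1/4 + (k:ℝ))/(1+(k:ℝ)))^3 := by gcongr
      _ = _ := one_mul _

lemma cert1 (n k : ℕ) : (8 * n + 1) * (8 * n + 5) * AA n * w1 n k
    - (8 * n + 9) * (8 * n + 13) * AA (n+1) * w1 (n+1) k = AA n * h1 n k - AA n * h1 n (k+1) := by
  unfold w1 h1
  rw [v1_succ_n, v1_succ_k, AA_succ]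
  push_cast
  generalize AA n = A
  generalize v1 n k = v
  unfold P1
  have hk : (0:ℝ) ≤ k := by positivity
  have hn : (0:ℝ) ≤ n := by positivity
  generalize (k:ℝ) = k at *
  generalize (n:ℝ) = n at *
  rw [show 2 * n + 1 + (k + 1) = 2 * n + 2 + k by ring]
  have e1 : 2 * n + 2 + k ≠ 0 := by positivity
  have e2 : 2 * n + 1 + k ≠ 0 := by positivity
  have e3 : n + 1 + k ≠ 0 := by positivity
  have e4 : n + 3/4 + k ≠ 0 := by positivity
  have e5 : n + 1/2 ≠ 0 := by positivity
  have e6 : n + 1/4 ≠ 0 := by positivity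
  have e7 : 9/8 + n ≠ 0 := by positivity
  have e8 : 13/8 + n ≠ 0 := by positivity
  have e9 : 1 + n ≠ 0 := by positivity
  field_simp
  ring

lemma sum_w1 (n : ℕ) : Summable (w1 n) := by
  refine Summable.of_nonneg_of_le (fun k => by have := v1_pos n k; unfold w1; positivity) (fun k => ?_)
    (summ_dom.mul_left (2 * n + 2 : ℝ))
  unfold w1
  rw [← mul_assoc]
  have := v1_pos n k
  apply mul_le_mul _ (v1_le n k) this.le (by positivity)
  have : (0:ℝ) ≤ n * k := by positivity
  nlinarith

noncomputable def W1 (n : ℕ) : ℝ := ∑' k, w1 n k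

lemma W1_nonneg (n : ℕ) : 0 ≤ W1 n :=
  tsum_nonneg (fun k => by have := v1_pos n k; unfold w1; positivity)

lemma W1_le : ∃ c : ℝ, ∀ n, W1 n ≤ (2 * n + 2) * c := by
  refine ⟨∑' k : ℕ, ((k:ℝ)+1) * xx k ^ 3, fun n => ?_⟩
  rw [← tsum_mul_left]
  refine (sum_w1 n).tsum_le_tsum (fun k => ?_) (summ_dom.mul_left (2 * n + 2 : ℝ))
  unfold w1
  rw [← mul_assoc]
  have := v1_pos n k
  apply mul_le_mul _ (v1_le n k) this.le (by positivity)
  have : (0:ℝ) ≤ n * k := by positivity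
  nlinarith

lemma lim_h1 (n : ℕ) : Filter.Tendsto (h1 n) Filter.atTop (nhds 0) := by
  have h := lim_dom.const_mul (P1 n 1)
  rw [mul_zero] at h
  have hP : ∀ k : ℕ, 0 ≤ P1 n k := fun k => by unfold P1; positivity
  refine squeeze_zero (fun k => ?_) (fun k => ?_) h
  · have := v1_pos n k; have := hP k; unfold h1; positivity
  · unfold h1
    rw [div_le_iff₀ (by positivity)]
    have hk : (0:ℝ) ≤ k := by positivity
    have e : P1 n k ≤ P1 n 1 * (k+1)^4 := by
      unfold P1
      have a0 : (1:ℝ) ≤ (k+1)^4 := one_le_pow₀ (by linarith)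
      have a1 : (k:ℝ) ≤ (k+1)^4 := by nlinarith [pow_nonneg hk 2, pow_nonneg hk 3, pow_nonneg hk 4]
      have a2 : (k:ℝ)^2 ≤ (k+1)^4 := by nlinarith [pow_nonneg hk 2, pow_nonneg hk 3, pow_nonneg hk 4]
      have a3 : (k:ℝ)^3 ≤ (k+1)^4 := by nlinarith [pow_nonneg hk 2, pow_nonneg hk 3, pow_nonneg hk 4]
      have a4 : (k:ℝ)^4 ≤ (k+1)^4 := by gcongr; linarith
      simp only [one_pow, mul_one, add_mul _ _ (((k:ℝ)+1)^4)]
      rw [← add_mul, ← add_mul, ← add_mul, ← add_mul, ← add_mul]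
      have c0 := mul_le_mul_of_nonneg_left a0 (show (0:ℝ) ≤ 21/16 + 105/4*n + 777/4*n^2 + 624*n^3 + 900*n^4 + 480*n^5 by positivity)
      have c1 := mul_le_mul_of_nonneg_left a1 (show (0:ℝ) ≤ 16 + 208*n + 912*n^2 + 1632*n^3 + 1024*n^4 by positivity)
      have c2 := mul_le_mul_of_nonneg_left a2 (show (0:ℝ) ≤ 43 + 374*n + 968*n^2 + 768*n^3 by positivity)
      have c3 := mul_le_mul_of_nonneg_left a3 (show (0:ℝ) ≤ 50 + 240*n + 256*n^2 by positivity)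
      have c4 := mul_le_mul_of_nonneg_left a4 (show (0:ℝ) ≤ 20 + 32*n by positivity)
      linarith
    have hn : (0:ℝ) ≤ n := by positivity
    calc v1 n k * P1 n k ≤ xx k ^ 3 * (P1 n 1 * (k+1)^4) :=
          mul_le_mul (v1_le n k) e (hP k) (by have := xx_pos k; positivity)
      _ = P1 n 1 * (((k:ℝ)+1)^2 * xx k ^ 3) * ((k:ℝ)+1)^2 := by ring
      _ ≤ _ := by
        have := xx_pos k
        have : 0 ≤ P1 n 1 := by exact_mod_cast hP 1
        have : ((k:ℝ)+1)^2 ≤ (2 * n + 1 + k)^2 := by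
          apply pow_le_pow_left₀ (by positivity); linarith
        gcongr

lemma tele {f g h : ℕ → ℝ} (hf : Summable f) (hg : Summable g)
    (hh : Filter.Tendsto h Filter.atTop (nhds 0)) (e : ∀ k, f k - g k = h k - h (k+1)) :
    ∑' k, f k - ∑' k, g k = h 0 := by
  rw [← hf.tsum_sub hg]
  have h1 := (hf.sub hg).hasSum.tendsto_sum_nat
  have h2 : Filter.Tendsto (fun n => ∑ k ∈ Finset.range n, (f k - g k)) Filter.atTop (nhds (h 0)) := by
    have : ∀ n, ∑ k ∈ Finset.range n, (f k - g k) = h 0 - h n := fun n => by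
      simp_rw [e]; exact Finset.sum_range_sub' h n
    simp_rw [this]
    simpa using hh.const_sub (h 0)
  exact tendsto_nhds_unique h1 h2

lemma step1 (n : ℕ) : (8 * n + 1) * (8 * n + 5) * AA n * W1 n
    - (8 * n + 9) * (8 * n + 13) * AA (n+1) * W1 (n+1) =
    (3/16) * (AA n * (640 * (n : ℝ) ^ 3 + 560 * (n : ℝ) ^ 2 + 112 * n + 7)) := by
  have h := tele ((sum_w1 n).mul_left ((8 * n + 1) * (8 * n + 5) * AA n))
    ((sum_w1 (n+1)).mul_left ((8 * n + 9) * (8 * n + 13) * AA (n+1)))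
    (h := fun k => AA n * h1 n k) (by simpa using (lim_h1 n).const_mul (AA n)) (cert1 n)
  rw [tsum_mul_left, tsum_mul_left] at h
  unfold W1
  rw [h]
  simp only [h1, v1, poch_zero, P1]
  push_cast
  field_simp
  ring

lemma AA_le (n : ℕ) : AA n ≤ (1/16)^n := by
  induction n with
  | zero => simp [AA, poch_zero]
  | succ n ih =>
    rw [AA_succ, pow_succ (1/16 : ℝ)]
    apply mul_le_mul ih _ (by positivity) (by positivity)
    have hn : (0:ℝ) ≤ n := by positivity
    rw [div_le_iff₀ (by positivity)]
    apply mul_le_mul_of_nonneg_left _ (by norm_num)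
    rw [show (1 + (n:ℝ))^3 = (1 + n) * (1 + n) * (1 + n) by ring]
    gcongr <;> norm_num

lemma lim1 : Filter.Tendsto (fun n : ℕ => (8 * n + 1) * (8 * n + 5) * AA n * W1 n) Filter.atTop (nhds 0) := by
  obtain ⟨c, hc⟩ := W1_le
  have l0 := tendsto_pow_const_mul_const_pow_of_lt_one 0 (r := (1/16:ℝ)) (by norm_num) (by norm_num)
  have l1 := tendsto_pow_const_mul_const_pow_of_lt_one 1 (r := (1/16:ℝ)) (by norm_num) (by norm_num)
  have l2 := tendsto_pow_const_mul_const_pow_of_lt_one 2 (r := (1/16:ℝ)) (by norm_num) (by norm_num)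
  have l3 := tendsto_pow_const_mul_const_pow_of_lt_one 3 (r := (1/16:ℝ)) (by norm_num) (by norm_num)
  have l := (((l3.const_mul (128*c)).add (l2.const_mul (224*c))).add (l1.const_mul (106*c))).add (l0.const_mul (10*c))
  simp only [mul_zero, add_zero] at l
  refine squeeze_zero (fun n => ?_) (fun n => ?_) l
  · have := AA_pos n; have := W1_nonneg n; positivity
  · have h0 := AA_pos n
    have h1 := W1_nonneg n
    calc (8 * (n:ℝ) + 1) * (8 * n + 5) * AA n * W1 n
        ≤ (8 * n + 1) * (8 * n + 5) * (1/16)^n * ((2 * n + 2) * c) := by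
          gcongr
          · exact AA_le n
          · exact hc n
      _ = _ := by ring

/-! Second family -/

noncomputable def v2 (m k : ℕ) : ℝ :=
  poch (m + 1/4) k * poch (1/2) k * poch (1/4) k ^ 2 /
    (poch 1 k * poch (m + 3/4) k * poch (m + 1) k ^ 2)

noncomputable def w2 (m k : ℕ) : ℝ := (m + 1/4 + 2 * k) * v2 m k

noncomputable def h2 (m k : ℕ) : ℝ := v2 m k * (k * (k + 2 * m + 1/2)) / (m + 1/4)

lemma v2_pos (m k : ℕ) : 0 < v2 m k := by
  have h1 := poch_pos (x := (m:ℝ) + 1/4) (by positivity) k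
  have h2 := poch_pos (x := 1/2) (by positivity) k
  have h3 := poch_pos (x := (1/4 : ℝ)) (by positivity) k
  have h4 := poch_pos (x := (m:ℝ) + 3/4) (by positivity) k
  have h5 := poch_pos (x := (m:ℝ) + 1) (by positivity) k
  have h6 := poch_pos (x := 1) (by positivity) k
  unfold v2; positivity

lemma v2_succ_k (m k : ℕ) : v2 m (k+1) = v2 m k *
    ((m + 1/4 + k) * (1/2 + k) * (1/4 + k)^2 /
      ((1 + k) * (m + 3/4 + k) * (m + 1 + k)^2)) := by
  unfold v2; simp only [poch_succ]
  rw [div_mul_div_comm]; congr 1 <;> ring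

lemma v2_succ_m (m k : ℕ) : v2 (m+1) k = v2 m k *
    (((m + 1/4 + k) / (m + 1/4)) *
      ((m + 3/4) / (m + 3/4 + k)) * ((m + 1) / (m + 1 + k))^2) := by
  have h4 := poch_pos (x := (m:ℝ) + 3/4) (by positivity) k
  have h5 := poch_pos (x := (m:ℝ) + 1) (by positivity) k
  have h6 := poch_pos (x := 1) (by positivity) k
  unfold v2
  push_cast
  rw [show (m:ℝ) + 1 + 1/4 = (m + 1/4) + 1 by ring,
    show (m:ℝ) + 1 + 3/4 = (m + 3/4) + 1 by ring, 
    poch_shift (x := (m:ℝ) + 1/4) (by positivity),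
    poch_shift (x := (m:ℝ) + 3/4) (by positivity), poch_shift (x := (m:ℝ) + 1) (by positivity)]
  generalize poch ((m:ℝ) + 3/4) k = a4 at *
  generalize poch ((m:ℝ) + 1) k = a5 at *
  generalize poch 1 k = a6 at *
  field_simp

lemma v2_le (m k : ℕ) : v2 m k ≤ xx k ^ 3 := by
  induction k with
  | zero => simp [v2, xx, poch_zero]
  | succ k ih =>
    rw [v2_succ_k, xx_succ, mul_pow]
    apply mul_le_mul ih _ (by positivity) (by have := xx_pos k; positivity)
    have hk : (0:ℝ) ≤ k := by positivity
    rw [div_pow, div_le_div_iff₀ (by positivity) (by positivity)]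
    have a : ((m:ℝ) + 1/4 + k) * (1/2 + k) * (1 + k)^2 ≤ (1/4 + k) * (m + 3/4 + k) * (m + 1 + k)^2 := by
      rcases Nat.eq_zero_or_pos m with rfl | hn
      · simp only [Nat.cast_zero]
        nlinarith [pow_nonneg hk 2, pow_nonneg hk 3]
      · obtain ⟨j, rfl⟩ := Nat.exists_eq_add_of_le' hn
        push_cast
        rw [← sub_nonneg]
        ring_nf
        positivity
    calc ((m:ℝ) + 1/4 + (k:ℝ)) * (1/2 + (k:ℝ)) * (1/4 + (k:ℝ))^2 * (1 + (k:ℝ))^3 =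
        (((m:ℝ) + 1/4 + (k:ℝ)) * (1/2 + (k:ℝ)) * (1 + (k:ℝ))^2) * ((1/4 + (k:ℝ))^2 * (1 + (k:ℝ))) := by ring
      _ ≤ ((1/4 + (k:ℝ)) * (m + 3/4 + (k:ℝ)) * (m + 1 + (k:ℝ))^2) * ((1/4 + (k:ℝ))^2 * (1 + (k:ℝ))) := by gcongr
      _ = _ := by ring

lemma cert2 (m k : ℕ) : w2 m k - ((m + 1/2)/(m+1))^2 * w2 (m+1) k = h2 m k - h2 m (k+1) := by
  unfold w2 h2
  rw [v2_succ_m, v2_succ_k]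
  push_cast
  generalize v2 m k = v
  have hk : (0:ℝ) ≤ k := by positivity
  have hn : (0:ℝ) ≤ m := by positivity
  generalize (k:ℝ) = k at *
  generalize (m:ℝ) = n at *
  have e3 : n + 1 + k ≠ 0 := by positivity
  have e4 : n + 3/4 + k ≠ 0 := by positivity
  have e6 : n + 1/4 ≠ 0 := by positivity
  have e9 : 1 + k ≠ 0 := by positivity
  field_simp
  ring

lemma w2_le (m k : ℕ) : w2 m k / (m + 1/4) ≤ 8 * (((k:ℝ)+1) * xx k ^ 3) := by
  rw [div_le_iff₀ (by positivity)]
  unfold w2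
  have h := v2_le m k
  have := v2_pos m k
  calc ((m:ℝ) + 1/4 + 2 * k) * v2 m k ≤ (8 * ((k:ℝ)+1) * (m + 1/4)) * xx k ^ 3 := by
        apply mul_le_mul _ h this.le (by positivity)
        have : (0:ℝ) ≤ m * k := by positivity
        have : (0:ℝ) ≤ m := by positivity
        nlinarith
    _ = _ := by ring

lemma w2_nonneg (m k : ℕ) : 0 ≤ w2 m k := by have := v2_pos m k; unfold w2; positivity

lemma sum_w2 (m : ℕ) : Summable (w2 m) := by
  have : Summable (fun k => w2 m k / (m + 1/4)) :=
    Summable.of_nonneg_of_le (fun k => by have := w2_nonneg m k; positivity) (w2_le m) (summ_dom.mul_left 8)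
  have h := this.mul_right ((m:ℝ) + 1/4)
  refine h.congr fun k => ?_
  field_simp

noncomputable def W2 (m : ℕ) : ℝ := ∑' k, w2 m k

lemma lim_h2 (m : ℕ) : Filter.Tendsto (h2 m) Filter.atTop (nhds 0) := by
  have h := lim_dom.const_mul (8 * m + 4 : ℝ)
  rw [mul_zero] at h
  refine squeeze_zero (fun k => ?_) (fun k => ?_) h
  · have := v2_pos m k; unfold h2; positivity
  · unfold h2
    rw [div_le_iff₀ (by positivity)]
    have := v2_pos m k
    calc v2 m k * (k * (k + 2 * m + 1/2)) ≤ xx k ^ 3 * ((8 * m + 4) * (k+1)^2 * (m + 1/4)) := by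
          apply mul_le_mul (v2_le m k) _ (by positivity) (by have := xx_pos k; positivity)
          rw [← sub_nonneg]
          ring_nf
          positivity
      _ = _ := by ring

lemma step2 (m : ℕ) : W2 m = ((m + 1/2)/(m+1))^2 * W2 (m+1) := by
  have h := tele (sum_w2 m) ((sum_w2 (m+1)).mul_left ((((m:ℝ) + 1/2)/(m+1))^2)) (lim_h2 m) (cert2 m)
  rw [tsum_mul_left] at h
  unfold W2
  simp [h2] at h
  linear_combination h

lemma W2_zero (m : ℕ) : W2 0 = (poch (1/2) m / poch 1 m)^2 * W2 m := by
  induction m with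
  | zero => simp [poch_zero]
  | succ m ih =>
    have h := poch_pos (x := 1) (by norm_num) m
    rw [ih, step2, poch_succ, poch_succ]
    field_simp
    ring

lemma v2_lim (k : ℕ) : Filter.Tendsto (fun m : ℕ => v2 m (k+1) * (1 + 8 * (k+1))) Filter.atTop (nhds 0) := by
  have h : Filter.Tendsto (fun m : ℕ => (1 / ((m:ℝ) + 1)) * ((1 + k) * (1 + 8 * ((k:ℝ)+1)))) Filter.atTop (nhds 0) := by
    simpa using (tendsto_one_div_add_atTop_nhds_zero_nat (𝕜 := ℝ)).mul_const ((1 + (k:ℝ)) * (1 + 8 * ((k:ℝ)+1)))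
  refine squeeze_zero (fun m => by have := v2_pos m (k+1); positivity) (fun m => ?_) h
  rw [← mul_assoc]
  apply mul_le_mul_of_nonneg_right _ (by positivity)
  have hx : v2 m k ≤ 1 := by
    refine (v2_le m k).trans (pow_le_one₀ (xx_pos k).le ?_)
    unfold xx
    rw [div_le_one (poch_pos (by norm_num) k)]
    unfold poch
    apply Finset.prod_le_prod
    · intro i _; positivity
    · intro i _; gcongr; norm_num
  rw [v2_succ_k]
  have hk : (0:ℝ) ≤ k := by positivity
  have hm : (0:ℝ) ≤ m := by positivity
  have : ((m:ℝ) + 1/4 + k) * (1/2 + k) * (1/4 + k)^2 /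
      ((1 + k) * (m + 3/4 + k) * (m + 1 + k)^2) ≤ 1 / (m + 1) * (1 + k) := by
    rw [div_mul_eq_mul_div, one_mul, div_le_div_iff₀ (by positivity) (by positivity)]
    calc ((m:ℝ) + 1/4 + (k:ℝ)) * (1/2 + (k:ℝ)) * (1/4 + (k:ℝ))^2 * ((m:ℝ) + 1)
        = ((m:ℝ) + 1/4 + (k:ℝ)) * (1/2 + (k:ℝ)) * ((1/4 + (k:ℝ)) * (1/4 + (k:ℝ))) * (m + 1) := by ring
      _ ≤ ((m:ℝ) + 3/4 + k) * (1 + k) * ((1 + k) * (m + 1 + k)) * (m + 1 + k) := by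
          have e1 : (m:ℝ) + 1/4 + k ≤ m + 3/4 + k := by linarith
          have e2 : 1/2 + (k:ℝ) ≤ 1 + k := by linarith
          have e3 : 1/4 + (k:ℝ) ≤ 1 + k := by linarith
          have e4 : 1/4 + (k:ℝ) ≤ m + 1 + k := by linarith
          have e5 : (m:ℝ) + 1 ≤ m + 1 + k := by linarith
          exact mul_le_mul (mul_le_mul (mul_le_mul e1 e2 (by positivity) (by positivity))
            (mul_le_mul e3 e4 (by positivity) (by positivity)) (by positivity) (by positivity)) e5
            (by positivity) (by positivity)
      _ = _ := by ring
  calc _ ≤ 1 * (1 / ((m:ℝ) + 1) * (1 + k)) := by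
        apply mul_le_mul hx this (by positivity) (by norm_num)
    _ = _ := one_mul _

lemma W2_lim : Filter.Tendsto (fun m : ℕ => W2 m / (m + 1/4)) Filter.atTop (nhds 1) := by
  have h := tendsto_tsum_of_dominated_convergence (𝓕 := Filter.atTop)
    (f := fun (m k : ℕ) => w2 m k / (m + 1/4)) (g := fun k => if k = 0 then 1 else 0)
    (bound := fun k => 8 * (((k:ℝ)+1) * xx k ^ 3)) (summ_dom.mul_left 8) ?_ ?_
  · rw [tsum_ite_eq] at h
    simpa only [tsum_div_const, W2] using h
  · intro k
    rcases k with _ | k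
    · have : ∀ m : ℕ, w2 m 0 / (m + 1/4) = 1 := fun m => by
        have h0 : (m:ℝ) + 1/4 ≠ 0 := by positivity
        simp only [w2, v2, poch_zero, Nat.cast_zero, mul_zero, add_zero, one_pow, mul_one, div_one]
        exact div_self h0
      simp [this, -one_div]
    · simp only [Nat.add_eq_zero_iff, one_ne_zero, and_false, if_false]
      refine squeeze_zero (fun m => by have := w2_nonneg m (k+1); positivity) (fun m => ?_) (v2_lim k)
      rw [div_le_iff₀ (by positivity)]
      unfold w2
      have := v2_pos m (k+1)
      rw [mul_comm, mul_assoc]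
      apply mul_le_mul_of_nonneg_left _ this.le
      rw [← sub_nonneg]
      push_cast
      ring_nf
      positivity
  · refine Filter.Eventually.of_forall fun m k => ?_
    rw [Real.norm_of_nonneg (by have := w2_nonneg m k; positivity)]
    exact w2_le m k

lemma wallis (m : ℕ) : (poch (1/2) m / poch 1 m)^2 * ((2 * m + 1) * Real.Wallis.W m) = 1 := by
  induction m with
  | zero => simp [poch_zero, Real.Wallis.W]
  | succ m ih =>
    refine Eq.trans ?_ ih
    rw [Real.Wallis.W_succ, poch_succ, poch_succ]
    have h := poch_pos (x := 1) (by norm_num) m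
    push_cast
    field_simp
    ring

lemma W2_val : W2 0 = 1 / π := by
  have l1 : Filter.Tendsto (fun m : ℕ => ((m:ℝ) + 1/4) / (2 * m + 1)) Filter.atTop (nhds (1/2)) := by
    have : ∀ m : ℕ, ((m:ℝ) + 1/4) / (2 * m + 1) = 1/2 - (1/4) * (1 / (2 * m + 1)) := fun m => by
      field_simp; ring
    simp_rw [this]
    have h := (tendsto_one_div_add_atTop_nhds_zero_nat (𝕜 := ℝ)).comp
      (Filter.tendsto_id.const_mul_atTop' (r := 2) (by norm_num))
    have h' : Filter.Tendsto (fun m : ℕ => 1 / (2 * (m:ℝ) + 1)) Filter.atTop (nhds 0) := by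
      refine h.congr fun m => ?_
      simp
    have h3 := (h'.const_mul (1/4)).const_sub (1/2)
    rwa [mul_zero, sub_zero] at h3
  have l := (W2_lim.mul l1).div Real.Wallis.tendsto_W_nhds_pi_div_two (by positivity)
  have hc : ∀ m : ℕ, W2 m / (m + 1/4) * (((m:ℝ) + 1/4) / (2 * m + 1)) / Real.Wallis.W m = W2 0 := fun m => by
    have hw := Real.Wallis.W_pos m
    have := wallis m
    rw [W2_zero m]
    have e : (m:ℝ) + 1/4 ≠ 0 := by positivity
    rw [div_mul_div_cancel₀ e, div_div, div_eq_iff (by positivity)]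
    linear_combination - W2 m * this
  have l' := l.congr hc
  rw [tendsto_nhds_unique tendsto_const_nhds l']
  field_simp

lemma W1_zero : W1 0 = W2 0 := by
  unfold W1 W2
  congr 1; funext k
  unfold w1 w2 v1 v2
  simp only [Nat.cast_zero, zero_add, mul_zero, add_zero]
  have h := poch_pos (x := 1) (by norm_num) k
  have h' := poch_pos (x := 3/4) (by norm_num) k
  field_simp

theorem series_80_div_3pi :
    (80 : ℝ) / (3 * π) = ∑' n : ℕ, (1 / 16 ^ n) *
      (poch (1/2) n * poch (1/4) n * poch (3/4) n * poch (3/8) n * poch (7/8) n /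
        (poch 1 n ^ 3 * poch (9/8) n * poch (13/8) n)) *
      (640 * (n : ℝ) ^ 3 + 560 * (n : ℝ) ^ 2 + 112 * n + 7) := by
  symm
  apply HasSum.tsum_eq
  change HasSum (fun n : ℕ => AA n * (640 * (n : ℝ) ^ 3 + 560 * (n : ℝ) ^ 2 + 112 * n + 7)) _
  rw [hasSum_iff_tendsto_nat_of_nonneg (fun n => by have := AA_pos n; positivity)]
  have e : ∀ N : ℕ, ∑ n ∈ Finset.range N, AA n * (640 * (n : ℝ) ^ 3 + 560 * (n : ℝ) ^ 2 + 112 * n + 7)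
      = (16/3) * (5 / π - (8 * N + 1) * (8 * N + 5) * AA N * W1 N) := by
    intro N
    induction N with
    | zero => simp [W1_zero, W2_val, AA, poch_zero]; ring
    | succ N ih =>
      rw [Finset.sum_range_succ, ih]
      have := step1 N
      push_cast
      linear_combination (-16/3) * this
  simp_rw [e]
  have := (lim1.const_sub (5/π)).const_mul (16/3)
  convert this using 2
  field_simp
  norm_num
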